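/- (Carleman estimate with h^{−4/3} weight.) Let V ∈ L^∞_{comp}(ℝ^d;ℂ) with ‖V‖_∞ ≤ C_V, let I ⊂ ℝ be a compact interval, and let R > 0. Then there exist a real-valued φ ∈ C^∞(ℝ^d), constants C > 0 and h₀ ∈ (0,1] such that for all u ∈ C_c^∞(B(0,R)), all λ ∈ I, and all 0 < h ≤ h₀: ∫ e^{2φ/h^{4/3}}(|u|² + |h∇u|²) dx ≤ (C/h^{2/3}) ∫ e^{2φ/h^{4/3}} |(−h²Δ + V − λ²)u|² dx. -/

import Mathlib

open Real Set MeasureTheory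

/-- The Laplacian of a complex-valued function on Euclidean space. -/
noncomputable def lapC {d : ℕ} (f : EuclideanSpace ℝ (Fin d) → ℂ)
    (x : EuclideanSpace ℝ (Fin d)) : ℂ :=
  ∑ i : Fin d, iteratedFDeriv ℝ 2 f x (fun _ => EuclideanSpace.single i 1)


namespace Carl

variable {d : ℕ}

/-- partial derivative -/
noncomputable def D {F : Type*} [NormedAddCommGroup F] [NormedSpace ℝ F] (i : Fin d)
    (f : EuclideanSpace ℝ (Fin d) → F) (x : EuclideanSpace ℝ (Fin d)) : F :=
  fderiv ℝ f x (EuclideanSpace.single i 1)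

section gen
variable {F : Type*} [NormedAddCommGroup F] [NormedSpace ℝ F]

lemma D_smooth {f : EuclideanSpace ℝ (Fin d) → F} (hf : ContDiff ℝ (⊤ : ℕ∞) f) (i : Fin d) :
    ContDiff ℝ (⊤ : ℕ∞) (D i f) := by
  unfold D
  exact (hf.fderiv_right (m := (⊤ : ℕ∞)) (by simp)).clm_apply contDiff_const

lemma sm_diff {f : EuclideanSpace ℝ (Fin d) → F} (hf : ContDiff ℝ (⊤ : ℕ∞) f) :
    Differentiable ℝ f := hf.differentiable (by simp)

lemma D_zero {f : EuclideanSpace ℝ (Fin d) → F} {K : Set (EuclideanSpace ℝ (Fin d))}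
    (hK : IsClosed K) (hf : ∀ x ∉ K, f x = 0) (i : Fin d) : ∀ x ∉ K, D i f x = 0 := by
  intro x hx
  have h : f =ᶠ[nhds x] (fun _ => (0:F)) := by
    filter_upwards [hK.isOpen_compl.mem_nhds hx] with z hz using hf z hz
  unfold D
  rw [h.fderiv_eq]; simp

lemma D_iter {f : EuclideanSpace ℝ (Fin d) → F} (hf : ContDiff ℝ (⊤ : ℕ∞) f) (i j : Fin d)
    (x : EuclideanSpace ℝ (Fin d)) :
    D i (D j f) x = fderiv ℝ (fderiv ℝ f) x (EuclideanSpace.single i 1)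
      (EuclideanSpace.single j 1) := by
  have h1 : DifferentiableAt ℝ (fderiv ℝ f) x :=
    ((hf.fderiv_right (m := (⊤ : ℕ∞)) (by simp)).differentiable (by simp)) x
  unfold D
  rw [fderiv_clm_apply h1 (differentiableAt_const _)]
  simp

lemma D_comm {f : EuclideanSpace ℝ (Fin d) → F} (hf : ContDiff ℝ (⊤ : ℕ∞) f) (i j : Fin d)
    (x : EuclideanSpace ℝ (Fin d)) : D i (D j f) x = D j (D i f) x := by
  rw [D_iter hf, D_iter hf]
  have : IsSymmSndFDerivAt ℝ f x :=
    hf.contDiffAt.isSymmSndFDerivAt (by simp only [minSmoothness_of_isRCLikeNormedField]; exact WithTop.coe_le_coe.2 le_top)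
  exact this _ _

end gen

lemma lapC_eq {f : EuclideanSpace ℝ (Fin d) → ℂ} (hf : ContDiff ℝ (⊤ : ℕ∞) f) 
    (x : EuclideanSpace ℝ (Fin d)) : lapC f x = ∑ i, D i (D i f) x := by
  unfold lapC
  refine Finset.sum_congr rfl fun i _ => ?_
  rw [D_iter hf, iteratedFDeriv_two_apply]

lemma D_mul {f g : EuclideanSpace ℝ (Fin d) → ℝ} (hf : Differentiable ℝ f)
    (hg : Differentiable ℝ g) (i : Fin d) (x) :
    D i (fun x => f x * g x) x = D i f x * g x + f x * D i g x := by
  unfold D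
  rw [fderiv_fun_mul (hf x) (hg x)]
  simp; ring

lemma D_add {f g : EuclideanSpace ℝ (Fin d) → ℝ} (hf : Differentiable ℝ f)
    (hg : Differentiable ℝ g) (i : Fin d) (x) :
    D i (fun x => f x + g x) x = D i f x + D i g x := by
  unfold D
  rw [fderiv_fun_add (hf x) (hg x)]
  simp

lemma D_const (c : ℝ) (i : Fin d) (x) :
    D i (fun _ => c) x = 0 := by
  unfold D
  simp

lemma D_cmul {f : EuclideanSpace ℝ (Fin d) → ℝ} (hf : Differentiable ℝ f)
    (c : ℝ) (i : Fin d) (x) :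
    D i (fun x => c * f x) x = c * D i f x := by
  rw [D_mul (by fun_prop) hf, D_const]; ring

lemma D_exp {f : EuclideanSpace ℝ (Fin d) → ℝ} (hf : Differentiable ℝ f) (i : Fin d) (x) :
    D i (fun x => Real.exp (f x)) x = Real.exp (f x) * D i f x := by
  unfold D
  rw [fderiv_exp (hf x)]
  simp

lemma D_y (c : ℝ) (i j : Fin d) (x) :
    D i (fun x : EuclideanSpace ℝ (Fin d) => x j + c) x = if i = j then 1 else 0 := by
  unfold D
  rw [fderiv_add_const]
  have : (fun x : EuclideanSpace ℝ (Fin d) => x j) = (EuclideanSpace.proj j : EuclideanSpace ℝ (Fin d) →L[ℝ] ℝ) := by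
    ext; simp
  rw [this, ContinuousLinearMap.fderiv]
  simp [eq_comm]

lemma int_of {f : EuclideanSpace ℝ (Fin d) → ℝ} {K : Set (EuclideanSpace ℝ (Fin d))}
    (hK : IsCompact K) (hc : Continuous f) (hf : ∀ x ∉ K, f x = 0) : Integrable f :=
  hc.integrable_of_hasCompactSupport (HasCompactSupport.intro hK hf)

lemma int_D {f : EuclideanSpace ℝ (Fin d) → ℝ} {K : Set (EuclideanSpace ℝ (Fin d))}
    (hK : IsCompact K) (hc : ContDiff ℝ (⊤ : ℕ∞) f) (hf : ∀ x ∉ K, f x = 0) (i : Fin d) :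
    Integrable (D i f) ∧ ∫ x, D i f x = 0 := by
  have h1 : Integrable (D i f) := int_of hK (D_smooth hc i).continuous (D_zero hK.isClosed hf i)
  refine ⟨h1, ?_⟩
  have h1' : Integrable (fun x => fderiv ℝ f x (EuclideanSpace.single i 1)) volume := h1
  have := integral_mul_fderiv_eq_neg_fderiv_mul_of_integrable (μ := volume) (f := fun _ : EuclideanSpace ℝ (Fin d) => (1:ℝ)) (g := f)
    (v := EuclideanSpace.single i 1) (by simp) (by simpa only [one_mul] using h1')
    (by simpa using int_of hK hc.continuous hf) (fun _ _ => by fun_prop) (fun x _ => sm_diff hc x)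
  simpa [D] using this

/-- key estimate for the conjugated function -/
lemma keyA (i0 : Fin d) (c s : ℝ) (hs : 0 ≤ s) {K : Set (EuclideanSpace ℝ (Fin d))}
    (hK : IsCompact K) {v : EuclideanSpace ℝ (Fin d) → ℝ} (hv : ContDiff ℝ (⊤ : ℕ∞) v)
    (h0 : ∀ x ∉ K, v x = 0) :
    ∫ x, 4 * s ^ 3 * (x i0 + c) ^ 2 * v x ^ 2 ≤
      ∫ x, ((∑ i, D i (D i v) x) - 2 * s * (x i0 + c) * D i0 v x - s * v x
        + s ^ 2 * (x i0 + c) ^ 2 * v x) ^ 2 := by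
  have hyc : ContDiff ℝ (⊤ : ℕ∞) (fun x : EuclideanSpace ℝ (Fin d) => x i0 + c) := by fun_prop
  set y : EuclideanSpace ℝ (Fin d) → ℝ := fun x => x i0 + c with hy
  have hDv := D_smooth hv
  have hDDv := fun i j => D_smooth (hDv i) j
  have zD := D_zero hK.isClosed h0
  have zDD := fun i j => D_zero hK.isClosed (zD i) j
  have dy := sm_diff hyc
  have dv := sm_diff hv
  have dDv := fun i => sm_diff (hDv i)
  have cy := hyc.continuous
  have cv := hv.continuous
  have cDv := fun i => (hDv i).continuous
  have cDDv := fun i j => (hDDv i j).continuous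
  let G : Fin d → EuclideanSpace ℝ (Fin d) → ℝ := fun i x =>
    (-4 * s) * (y x * (D i v x * D i0 v x)) + (-2 * s) * (D i v x * v x)
  let H : Fin d → EuclideanSpace ℝ (Fin d) → ℝ := fun i x =>
    (2 * s) * (y x * (D i v x * D i v x))
  let H0 : EuclideanSpace ℝ (Fin d) → ℝ := fun x =>
    (-2 * s ^ 3) * (y x * (y x * y x) * (v x * v x))
  have hG : ∀ i, ContDiff ℝ (⊤ : ℕ∞) (G i) := fun i => by
    have := hDv i; have := hDv i0; unfold G; fun_prop
  have hH : ∀ i, ContDiff ℝ (⊤ : ℕ∞) (H i) := fun i => by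
    have := hDv i; unfold H; fun_prop
  have hH0 : ContDiff ℝ (⊤ : ℕ∞) H0 := by unfold H0; fun_prop
  have iG := fun i => int_D hK (hG i) (fun x hx => by simp [G, zD _ x hx]) i
  have iH := fun i => int_D hK (hH i) (fun x hx => by simp [H, zD _ x hx]) i0
  have iH0 := int_D hK hH0 (fun x hx => by simp [H0, h0 x hx]) i0
  have eG : ∀ i x, D i (G i) x = (-4 * s) * ((if i = i0 then 1 else 0) * (D i v x * D i0 v x)
      + y x * (D i (D i v) x * D i0 v x + D i v x * D i0 (D i v) x))
      + (-2 * s) * (D i (D i v) x * v x + D i v x * D i v x) := by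
    intro i x
    have := dDv i; have := dDv i0
    unfold G
    rw [D_add (by fun_prop) (by fun_prop), D_cmul (by fun_prop), D_cmul (by fun_prop),
      D_mul (by fun_prop) (by fun_prop), D_mul (by fun_prop) (by fun_prop),
      D_mul (by fun_prop) (by fun_prop), D_y, D_comm hv i i0]
  have eH : ∀ i x, D i0 (H i) x = (2 * s) * (D i v x * D i v x
      + 2 * (y x * (D i v x * D i0 (D i v) x))) := by
    intro i x
    have := dDv i
    unfold H
    rw [D_cmul (by fun_prop),
      D_mul (by fun_prop) (by fun_prop), D_mul (by fun_prop) (by fun_prop), D_y, if_pos rfl]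
    ring
  have eH0 : ∀ x, D i0 H0 x = (-2 * s ^ 3) * (3 * y x ^ 2 * v x ^ 2 + 2 * y x ^ 3 * v x * D i0 v x) := by
    intro x
    unfold H0
    rw [D_cmul (by fun_prop),
      D_mul (by fun_prop) (by fun_prop), D_mul (by fun_prop) (by fun_prop),
      D_mul (by fun_prop) (by fun_prop), D_mul (by fun_prop) (by fun_prop), D_y, if_pos rfl]
    ring
  have e1 : ∀ x, (∑ i, (D i (G i) x + D i0 (H i) x))
      = (-4 * s * y x * D i0 v x - 2 * s * v x) * (∑ i, D i (D i v) x) - 4 * s * D i0 v x ^ 2 := by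
    intro x
    have : ∀ i, D i (G i) x + D i0 (H i) x = (-4 * s * y x * D i0 v x - 2 * s * v x) * D i (D i v) x
       + (if i = i0 then (-4 * s * D i0 v x ^ 2) else 0) := by
      intro i
      rw [eG, eH]
      by_cases h : i = i0
      · subst h; simp; ring
      · simp [h]; ring
    simp only [this, Finset.sum_add_distrib, ← Finset.mul_sum, Finset.sum_ite_eq', Finset.mem_univ, if_true]
    ring
  have iGH : ∀ i ∈ Finset.univ, Integrable (fun x => D i (G i) x + D i0 (H i) x) :=
    fun i _ => (iG i).1.add (iH i).1
  have iDiv : Integrable (fun x => (∑ i, (D i (G i) x + D i0 (H i) x)) + D i0 H0 x) :=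
    (integrable_finsetSum _ iGH).add iH0.1
  have zDiv : ∫ x, ((∑ i, (D i (G i) x + D i0 (H i) x)) + D i0 H0 x) = 0 := by
    rw [integral_add (integrable_finsetSum _ iGH) iH0.1,
      integral_finsetSum _ iGH, iH0.2]
    simp only [add_zero]
    refine Finset.sum_eq_zero fun i _ => ?_
    rw [integral_add (iG i).1 (iH i).1, (iG i).2, (iH i).2, add_zero]
  have iL : Integrable (fun x => 4 * s ^ 3 * (y x) ^ 2 * v x ^ 2) :=
    int_of hK (by fun_prop) (fun x hx => by simp [h0 x hx])
  calc ∫ x, 4 * s ^ 3 * (y x) ^ 2 * v x ^ 2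
      = ∫ x, (4 * s ^ 3 * (y x) ^ 2 * v x ^ 2 + 
        ((∑ i, (D i (G i) x + D i0 (H i) x)) + D i0 H0 x)) := by
        rw [integral_add iL iDiv, zDiv, add_zero]
    _ ≤ _ := by
        refine integral_mono (iL.add iDiv) ?_ ?_
        · refine int_of hK ?_ (fun x hx => by simp [h0 x hx, zD _ x hx, zDD _ _ x hx])
          have := cDv i0
          have : Continuous fun x => ∑ i, D i (D i v) x :=
            continuous_finsetSum _ fun i _ => cDDv i i
          fun_prop
        · intro x
          simp only [e1, eH0]
          set A := ∑ i, D i (D i v) x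
          change _ ≤ (A - 2 * s * y x * D i0 v x - s * v x + s ^ 2 * y x ^ 2 * v x) ^ 2
          have t := sq_nonneg (A + s ^ 2 * y x ^ 2 * v x)
          have t2 := sq_nonneg (2 * s * y x * D i0 v x + s * v x)
          have t3 := mul_nonneg hs (sq_nonneg (D i0 v x))
          nlinarith

/-- Real-valued Carleman estimate for the Laplacian -/
lemma realC (i0 : Fin d) (c s : ℝ) (hs : 1 ≤ s) {K : Set (EuclideanSpace ℝ (Fin d))}
    (hK : IsCompact K) (hyK : ∀ x ∈ K, 1 ≤ x i0 + c)
    {u : EuclideanSpace ℝ (Fin d) → ℝ} (hu : ContDiff ℝ (⊤ : ℕ∞) u)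
    (h0 : ∀ x ∉ K, u x = 0) :
    4 * s ^ 3 * ∫ x, Real.exp (s * (x i0 + c) ^ 2) * u x ^ 2 ≤
      ∫ x, Real.exp (s * (x i0 + c) ^ 2) * (∑ i, D i (D i u) x) ^ 2 ∧
    s * ∫ x, Real.exp (s * (x i0 + c) ^ 2) * ∑ i, D i u x ^ 2 ≤
      9 / 4 * ∫ x, Real.exp (s * (x i0 + c) ^ 2) * (∑ i, D i (D i u) x) ^ 2 := by
  have hyc : ContDiff ℝ (⊤ : ℕ∞) (fun x : EuclideanSpace ℝ (Fin d) => x i0 + c) := by fun_prop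
  have hDy := fun i => D_y c i i0
  set y : EuclideanSpace ℝ (Fin d) → ℝ := fun x => x i0 + c with hy
  have hDu := D_smooth hu
  have hDDu := fun i j => D_smooth (hDu i) j
  have zD := D_zero hK.isClosed h0
  have zDD := fun i j => D_zero hK.isClosed (zD i) j
  have dy := sm_diff hyc
  have du := sm_diff hu
  have dDu := fun i => sm_diff (hDu i)
  have cy := hyc.continuous
  have cu := hu.continuous
  have cDu := fun i => (hDu i).continuous
  have cDDu := fun i j => (hDDu i j).continuous
  have cL : Continuous fun x => ∑ i, D i (D i u) x := continuous_finsetSum _ fun i _ => cDDu i i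
  have cN : Continuous fun x => ∑ i, D i u x ^ 2 := continuous_finsetSum _ fun i _ => (cDu i).pow 2
  change 4 * s ^ 3 * ∫ x, Real.exp (s * (y x) ^ 2) * u x ^ 2 ≤
      ∫ x, Real.exp (s * (y x) ^ 2) * (∑ i, D i (D i u) x) ^ 2 ∧
    s * ∫ x, Real.exp (s * (y x) ^ 2) * ∑ i, D i u x ^ 2 ≤
      9 / 4 * ∫ x, Real.exp (s * (y x) ^ 2) * (∑ i, D i (D i u) x) ^ 2
  have hyK' : ∀ x ∈ K, 1 ≤ y x := hyK
  -- the conjugated function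
  let E : EuclideanSpace ℝ (Fin d) → ℝ := fun x => Real.exp ((s / 2) * (y x * y x))
  have hE : ContDiff ℝ (⊤ : ℕ∞) E := by unfold E; fun_prop
  have dE := sm_diff hE
  have eE : ∀ i x, D i E x = E x * (s * (if i = i0 then 1 else 0) * y x) := by
    intro i x
    unfold E
    rw [D_exp (by fun_prop), D_cmul (by fun_prop), D_mul dy dy, hDy]
    ring
  have EE : ∀ x, E x ^ 2 = Real.exp (s * (y x) ^ 2) := by
    intro x
    simp only [E]
    rw [← Real.exp_nat_mul]
    congr 1
    push_cast; ring
  let v : EuclideanSpace ℝ (Fin d) → ℝ := fun x => E x * u x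
  have hv : ContDiff ℝ (⊤ : ℕ∞) v := hE.mul hu
  have v0 : ∀ x ∉ K, v x = 0 := fun x hx => by simp [v, h0 x hx]
  have eDv : ∀ i, D i v = fun x => E x * (D i u x + s * (if i = i0 then 1 else 0) * (y x * u x)) := by
    intro i; funext x
    unfold v
    rw [D_mul dE du, eE]; ring
  have eDDv : ∀ i x, D i (D i v) x = E x * (D i (D i u) x +
      (if i = i0 then 2 * s * y x * D i0 u x + (s + s ^ 2 * y x ^ 2) * u x else 0)) := by
    intro i x
    have := dDu i
    rw [eDv, D_mul dE (by fun_prop), D_add (by fun_prop) (by fun_prop), D_cmul (by fun_prop),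
      D_mul dy du, hDy, eE]
    by_cases h : i = i0
    · subst h; simp; ring
    · simp [h]
  have iw : Integrable fun x => Real.exp (s * (y x) ^ 2) * (∑ i, D i (D i u) x) ^ 2 :=
    int_of hK (by fun_prop) (fun x hx => by simp [zDD _ _ x hx])
  have iu : Integrable fun x => Real.exp (s * (y x) ^ 2) * u x ^ 2 :=
    int_of hK (by fun_prop) (fun x hx => by simp [h0 x hx])
  have iyu : Integrable fun x => Real.exp (s * (y x) ^ 2) * (y x ^ 2 * u x ^ 2) :=
    int_of hK (by fun_prop) (fun x hx => by simp [h0 x hx])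
  have iN : Integrable fun x => Real.exp (s * (y x) ^ 2) * ∑ i, D i u x ^ 2 :=
    int_of hK (by fun_prop) (fun x hx => by simp [zD _ x hx])
  -- pointwise lower bound of y on the support
  have yu : ∀ x, u x ^ 2 ≤ y x ^ 2 * u x ^ 2 := by
    intro x
    by_cases hx : x ∈ K
    · have := hyK' x hx
      nlinarith [sq_nonneg (u x), mul_nonneg (sq_nonneg (u x)) (show 0 ≤ y x ^ 2 - 1 by nlinarith)]
    · simp [h0 x hx]
  have main : 4 * s ^ 3 * ∫ x, Real.exp (s * (y x) ^ 2) * (y x ^ 2 * u x ^ 2) ≤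
      ∫ x, Real.exp (s * (y x) ^ 2) * (∑ i, D i (D i u) x) ^ 2 := by
    have hA := keyA i0 c s (by linarith) hK hv v0
    rw [← integral_const_mul]
    refine le_of_eq_of_le ?_ (hA.trans_eq ?_)
    · congr 1; funext x
      rw [← EE]
      change _ = 4 * s ^ 3 * (y x) ^ 2 * (E x * u x) ^ 2
      ring
    · congr 1; funext x
      rw [← EE]
      simp only [eDDv, ← Finset.mul_sum, Finset.sum_add_distrib, Finset.sum_ite_eq',
        Finset.mem_univ, if_true]
      simp only [eDv, v, if_true]
      change (E x * _ - 2 * s * y x * _ - _ + s ^ 2 * y x ^ 2 * _) ^ 2 = _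
      ring
  have main0 : 4 * s ^ 3 * ∫ x, Real.exp (s * (y x) ^ 2) * u x ^ 2 ≤
      4 * s ^ 3 * ∫ x, Real.exp (s * (y x) ^ 2) * (y x ^ 2 * u x ^ 2) := by
    refine mul_le_mul_of_nonneg_left (integral_mono iu iyu fun x => ?_) (by positivity)
    exact mul_le_mul_of_nonneg_left (yu x) (Real.exp_pos _).le
  refine ⟨main0.trans main, ?_⟩
  -- gradient
  let W : EuclideanSpace ℝ (Fin d) → ℝ := fun x => Real.exp (s * (y x * y x))
  have hW : ContDiff ℝ (⊤ : ℕ∞) W := by unfold W; fun_prop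
  have dW := sm_diff hW
  have WW : ∀ x, Real.exp (s * y x ^ 2) = W x := fun x => by simp only [W, sq]
  have eW : ∀ i x, D i W x = W x * (2 * s * (if i = i0 then 1 else 0) * y x) := by
    intro i x
    unfold W
    rw [D_exp (by fun_prop), D_cmul (by fun_prop), D_mul dy dy, hDy]
    ring
  let G : Fin d → EuclideanSpace ℝ (Fin d) → ℝ := fun i x => W x * (u x * D i u x)
  have hG : ∀ i, ContDiff ℝ (⊤ : ℕ∞) (G i) := fun i => hW.mul (hu.mul (hDu i))
  have iG := fun i => int_D hK (hG i) (fun x hx => by simp [G, h0 x hx]) i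
  have eG : ∀ i x, D i (G i) x = W x * (D i u x ^ 2 + u x * D i (D i u) x +
      if i = i0 then 2 * s * y x * u x * D i0 u x else 0) := by
    intro i x
    unfold G
    have := dDu i
    rw [D_mul dW (by fun_prop), D_mul du (dDu i), eW]
    by_cases h : i = i0
    · subst h; simp; ring
    · simp only [h, if_false]; ring
  have zS : ∫ x, ∑ i, D i (G i) x = 0 := by
    rw [integral_finsetSum _ fun i _ => (iG i).1]
    exact Finset.sum_eq_zero fun i _ => (iG i).2
  have iS : Integrable fun x => ∑ i, D i (G i) x := integrable_finsetSum _ fun i _ => (iG i).1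
  have eS : ∀ x, ∑ i, D i (G i) x = W x * ((∑ i, D i u x ^ 2) + u x * (∑ i, D i (D i u) x)
      + 2 * s * y x * u x * D i0 u x) := by
    intro x
    simp only [eG, ← Finset.mul_sum, Finset.sum_add_distrib, Finset.sum_ite_eq',
        Finset.mem_univ, if_true]
  have key : s * ∫ x, Real.exp (s * (y x) ^ 2) * ∑ i, D i u x ^ 2 ≤
      (∫ x, Real.exp (s * (y x) ^ 2) * (∑ i, D i (D i u) x) ^ 2) +
      5 * s ^ 3 * ∫ x, Real.exp (s * (y x) ^ 2) * (y x ^ 2 * u x ^ 2) := by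
    have hz : s * ∫ x, Real.exp (s * (y x) ^ 2) * ∑ i, D i u x ^ 2 =
        ∫ x, (s * (Real.exp (s * (y x) ^ 2) * ∑ i, D i u x ^ 2) - 2 * s * ∑ i, D i (G i) x) := by
      rw [integral_sub (iN.const_mul _) (iS.const_mul _), integral_const_mul, integral_const_mul,
        zS]; ring
    rw [hz, ← integral_const_mul, ← integral_add iw (iyu.const_mul _)]
    refine integral_mono ((iN.const_mul _).sub (iS.const_mul _)) (iw.add (iyu.const_mul _)) fun x => ?_
    simp only [eS, WW]
    set N := ∑ i, D i u x ^ 2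
    set A := ∑ i, D i (D i u) x
    have hN : D i0 u x ^ 2 ≤ N :=
      Finset.single_le_sum (f := fun i => D i u x ^ 2) (fun i _ => sq_nonneg _) (Finset.mem_univ i0)
    have hw : 0 < W x := Real.exp_pos _
    have h1 := yu x
    have h2 : s * N - 2 * s * (N + u x * A + 2 * s * y x * u x * D i0 u x) ≤
        A ^ 2 + 5 * s ^ 3 * (y x ^ 2 * u x ^ 2) := by
      have q1 := sq_nonneg (A + s * u x)
      have q2 := mul_nonneg (show 0 ≤ s by linarith) (sq_nonneg (D i0 u x + 2 * s * y x * u x))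
      have q3 := mul_le_mul_of_nonneg_left hN (show 0 ≤ s by linarith)
      have q4 : s ^ 2 * u x ^ 2 ≤ s ^ 3 * (y x ^ 2 * u x ^ 2) := by
        refine mul_le_mul ?_ h1 (sq_nonneg _) (by positivity)
        exact pow_le_pow_right₀ hs (by norm_num)
      nlinarith
    have := mul_le_mul_of_nonneg_left h2 hw.le
    linarith
  linarith


lemma D_re {u : EuclideanSpace ℝ (Fin d) → ℂ} (hu : Differentiable ℝ u) (i : Fin d) :
    D i (fun x => (u x).re) = fun x => (D i u x).re := by
  funext x
  have := (Complex.reCLM.hasFDerivAt (x := u x)).comp x (hu x).hasFDerivAt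
  unfold D
  have h2 : HasFDerivAt (fun x => (u x).re) (Complex.reCLM.comp (fderiv ℝ u x)) x := this
  rw [h2.fderiv]; simp

lemma D_im {u : EuclideanSpace ℝ (Fin d) → ℂ} (hu : Differentiable ℝ u) (i : Fin d) :
    D i (fun x => (u x).im) = fun x => (D i u x).im := by
  funext x
  have := (Complex.imCLM.hasFDerivAt (x := u x)).comp x (hu x).hasFDerivAt
  unfold D
  have h2 : HasFDerivAt (fun x => (u x).im) (Complex.imCLM.comp (fderiv ℝ u x)) x := this
  rw [h2.fderiv]; simp

lemma nsq (z : ℂ) : ‖z‖ ^ 2 = z.re ^ 2 + z.im ^ 2 := by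
  rw [Complex.sq_norm, Complex.normSq_apply]; ring

/-- Complex-valued Carleman estimate for the Laplacian -/
lemma complexC (i0 : Fin d) (c s : ℝ) (hs : 1 ≤ s) {K : Set (EuclideanSpace ℝ (Fin d))}
    (hK : IsCompact K) (hyK : ∀ x ∈ K, 1 ≤ x i0 + c)
    {u : EuclideanSpace ℝ (Fin d) → ℂ} (hu : ContDiff ℝ (⊤ : ℕ∞) u)
    (h0 : ∀ x ∉ K, u x = 0) :
    4 * s ^ 3 * ∫ x, Real.exp (s * (x i0 + c) ^ 2) * ‖u x‖ ^ 2 ≤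
      ∫ x, Real.exp (s * (x i0 + c) ^ 2) * ‖∑ i, D i (D i u) x‖ ^ 2 ∧
    s * ∫ x, Real.exp (s * (x i0 + c) ^ 2) * ∑ i, ‖D i u x‖ ^ 2 ≤
      9 / 4 * ∫ x, Real.exp (s * (x i0 + c) ^ 2) * ‖∑ i, D i (D i u) x‖ ^ 2 := by
  have hf : ContDiff ℝ (⊤ : ℕ∞) (fun x => (u x).re) := Complex.reCLM.contDiff.comp hu
  have hg : ContDiff ℝ (⊤ : ℕ∞) (fun x => (u x).im) := Complex.imCLM.contDiff.comp hu
  have hF := realC i0 c s hs hK hyK hf (fun x hx => by simp [h0 x hx])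
  have hG := realC i0 c s hs hK hyK hg (fun x hx => by simp [h0 x hx])
  have hDu := D_smooth hu
  have dDu := fun i => sm_diff (hDu i)
  have du := sm_diff hu
  have zD := D_zero hK.isClosed h0
  have zDD := fun i j => D_zero hK.isClosed (zD i) j
  have cu := hu.continuous
  have cDu := fun i => (hDu i).continuous
  have cL : Continuous fun x => ∑ i, D i (D i u) x :=
    continuous_finsetSum _ fun i _ => (D_smooth (hDu i) i).continuous
  simp only [D_re du, D_im du, D_re (dDu _), D_im (dDu _), ← Complex.re_sum, ← Complex.im_sum] at hF hG
  have ew : Continuous fun x : EuclideanSpace ℝ (Fin d) => Real.exp (s * (x i0 + c) ^ 2) := by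
    fun_prop
  have cre := Complex.continuous_re
  have cim := Complex.continuous_im
  have a1 : ∫ x, Real.exp (s * (x i0 + c) ^ 2) * ‖u x‖ ^ 2 =
      (∫ x, Real.exp (s * (x i0 + c) ^ 2) * (u x).re ^ 2) +
      ∫ x, Real.exp (s * (x i0 + c) ^ 2) * (u x).im ^ 2 := by
    rw [← integral_add]
    · simp only [nsq, mul_add]
    · exact int_of hK (ew.mul ((cre.comp cu).pow 2)) (fun x hx => by simp [h0 x hx])
    · exact int_of hK (ew.mul ((cim.comp cu).pow 2)) (fun x hx => by simp [h0 x hx])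
  have a2 : ∫ x, Real.exp (s * (x i0 + c) ^ 2) * ‖∑ i, D i (D i u) x‖ ^ 2 =
      (∫ x, Real.exp (s * (x i0 + c) ^ 2) * (∑ i, D i (D i u) x).re ^ 2) +
      ∫ x, Real.exp (s * (x i0 + c) ^ 2) * (∑ i, D i (D i u) x).im ^ 2 := by
    rw [← integral_add]
    · simp only [nsq, mul_add]
    · exact int_of hK (ew.mul ((cre.comp cL).pow 2)) (fun x hx => by simp [zDD _ _ x hx])
    · exact int_of hK (ew.mul ((cim.comp cL).pow 2)) (fun x hx => by simp [zDD _ _ x hx])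
  have a3 : ∫ x, Real.exp (s * (x i0 + c) ^ 2) * ∑ i, ‖D i u x‖ ^ 2 =
      (∫ x, Real.exp (s * (x i0 + c) ^ 2) * ∑ i, (D i u x).re ^ 2) +
      ∫ x, Real.exp (s * (x i0 + c) ^ 2) * ∑ i, (D i u x).im ^ 2 := by
    rw [← integral_add]
    · simp only [nsq, Finset.sum_add_distrib, mul_add]
    · exact int_of hK (ew.mul (continuous_finsetSum _ fun i _ => (cre.comp (cDu i)).pow 2))
        (fun x hx => by simp [zD _ x hx])
    · exact int_of hK (ew.mul (continuous_finsetSum _ fun i _ => (cim.comp (cDu i)).pow 2))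
        (fun x hx => by simp [zD _ x hx])
  rw [a1, a2, a3]
  constructor
  · linarith [hF.1, hG.1]
  · linarith [hF.2, hG.2]

lemma norm_fderiv_le (u : EuclideanSpace ℝ (Fin d) → ℂ) (x : EuclideanSpace ℝ (Fin d)) :
    ‖fderiv ℝ u x‖ ^ 2 ≤ ∑ i, ‖D i u x‖ ^ 2 := by
  have hn : 0 ≤ ∑ i, ‖D i u x‖ ^ 2 := Finset.sum_nonneg fun i _ => sq_nonneg _
  rw [← Real.le_sqrt (norm_nonneg _) hn]
  refine ContinuousLinearMap.opNorm_le_bound _ (Real.sqrt_nonneg _) fun z => ?_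
  have hz : z = ∑ i, z i • EuclideanSpace.single i (1:ℝ) := by
    ext j; simp [Pi.single_apply]
  have h1 : ‖fderiv ℝ u x z‖ ≤ ∑ i, ‖D i u x‖ * ‖z i‖ := by
    conv_lhs => rw [hz]
    rw [map_sum]
    refine (norm_sum_le _ _).trans (Finset.sum_le_sum fun i _ => ?_)
    rw [map_smul, norm_smul, mul_comm]; rfl
  refine h1.trans ?_
  rw [EuclideanSpace.norm_eq]
  exact Real.sum_mul_le_sqrt_mul_sqrt _ _ _

lemma arith {q s κ M U Q A N : ℝ} (hq0 : 0 < q) (hq1 : q ≤ 1) (hsdef : s = κ / q ^ 2)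
    (hκ : κ = 1 + M ^ 2) (hκ1 : 1 ≤ κ) (I0 : 0 ≤ U) (IP0 : 0 ≤ Q)
    (c1 : 4 * s ^ 3 * U ≤ A) (c2 : s * N ≤ 9 / 4 * A)
    (b1 : q ^ 6 * A ≤ 2 * Q + 2 * M ^ 2 * U) :
    U + q ^ 3 * N ≤ 11 / 2 / q * Q := by
  have d1 : 4 * κ ^ 3 * U ≤ q ^ 6 * A := by
    have := mul_le_mul_of_nonneg_left c1 (show 0 ≤ q ^ 6 by positivity)
    have e : q ^ 6 * (4 * s ^ 3 * U) = 4 * κ ^ 3 * U := by rw [hsdef]; field_simp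
    linarith
  have d2 : κ * (q ^ 4 * N) ≤ 9 / 4 * (q ^ 6 * A) := by
    have := mul_le_mul_of_nonneg_left c2 (show 0 ≤ q ^ 6 by positivity)
    have e : q ^ 6 * (s * N) = κ * (q ^ 4 * N) := by rw [hsdef]; field_simp
    linarith
  have k3 : κ ≤ κ ^ 3 := by
    nlinarith [mul_nonneg (show 0 ≤ κ by linarith) (show 0 ≤ κ ^ 2 - 1 by nlinarith)]
  have d3 : U ≤ Q := by
    have e1 : 4 * κ * U ≤ 4 * κ ^ 3 * U := by nlinarith
    have e2 : 4 * κ * U = 4 * U + 4 * M ^ 2 * U := by rw [hκ]; ring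
    have e3 : 0 ≤ M ^ 2 * U := by positivity
    linarith
  have d4 : q ^ 6 * A ≤ 2 * κ * Q := by
    have : M ^ 2 * U ≤ M ^ 2 * Q := mul_le_mul_of_nonneg_left d3 (sq_nonneg _)
    have e : 2 * κ * Q = 2 * Q + 2 * M ^ 2 * Q := by rw [hκ]; ring
    linarith
  have d5 : q ^ 4 * N ≤ 9 / 2 * Q := by
    have : κ * (q ^ 4 * N) ≤ κ * (9 / 2 * Q) := by linarith
    exact le_of_mul_le_mul_left this (by linarith)
  rw [div_mul_eq_mul_div, le_div_iff₀ hq0]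
  have d6 : U * q ≤ Q := by nlinarith
  nlinarith

end Carl

set_option maxHeartbeats 1000000

/-- Carleman estimate with `h^{-4/3}` weight for bounded compactly supported
(possibly complex-valued) potentials. -/
theorem stmt_6 {d : ℕ} (hd : 1 ≤ d)
    (V : EuclideanSpace ℝ (Fin d) → ℂ) (hVmeas : Measurable V)
    (C_V R₀ : ℝ) (hCV : 0 < C_V) (hR₀ : 0 < R₀)
    (hVbd : ∀ x, ‖V x‖ ≤ C_V)
    (hVsupp : Function.support V ⊆ Metric.ball 0 R₀)
    (a b : ℝ) (hab : a ≤ b) (R : ℝ) (hR : 0 < R) :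
    ∃ (φ : EuclideanSpace ℝ (Fin d) → ℝ), ContDiff ℝ (⊤ : ℕ∞) φ ∧
      ∃ C > 0, ∃ h₀ ∈ Ioc (0:ℝ) 1,
        ∀ (u : EuclideanSpace ℝ (Fin d) → ℂ), ContDiff ℝ (⊤ : ℕ∞) u →
          tsupport u ⊆ Metric.ball 0 R →
          ∀ lam ∈ Icc a b, ∀ h : ℝ, 0 < h → h ≤ h₀ →
          ∫ x, Real.exp (2 * φ x / h ^ ((4:ℝ)/3)) * (‖u x‖ ^ 2 + ‖h • fderiv ℝ u x‖ ^ 2)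
            ≤ (C / h ^ ((2:ℝ)/3)) *
              ∫ x, Real.exp (2 * φ x / h ^ ((4:ℝ)/3)) *
                ‖(-(h ^ 2) : ℝ) • lapC u x + (V x - ((lam:ℂ) ^ 2)) * u x‖ ^ 2 := by
  have hK : IsCompact (Metric.closedBall (0 : EuclideanSpace ℝ (Fin d)) R) :=
    isCompact_closedBall _ _
  let i0 : Fin d := ⟨0, hd⟩
  have hyK : ∀ x ∈ Metric.closedBall (0 : EuclideanSpace ℝ (Fin d)) R, 1 ≤ x i0 + (R + 1) := by
    intro x hx
    have h1 : ‖x‖ ≤ R := by simpa using hx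
    have h2 : ‖x i0‖ ≤ ‖x‖ := PiLp.norm_apply_le x i0
    rw [Real.norm_eq_abs] at h2
    have := neg_abs_le (x i0)
    linarith
  set M : ℝ := C_V + a ^ 2 + b ^ 2 with hM
  have hM0 : 0 < M := by positivity
  set κ : ℝ := 1 + M ^ 2 with hκ
  have hκ1 : 1 ≤ κ := by nlinarith
  refine ⟨fun x => κ / 2 * (x i0 + (R + 1)) ^ 2, by fun_prop, 11 / 2, by norm_num, 1,
    ⟨one_pos, le_rfl⟩, ?_⟩
  intro u hu hsupp lam hlam h hh hh1
  have h0 : ∀ x ∉ Metric.closedBall (0 : EuclideanSpace ℝ (Fin d)) R, u x = 0 := by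
    intro x hx
    exact image_eq_zero_of_notMem_tsupport fun hx' => hx (Metric.ball_subset_closedBall (hsupp hx'))
  set q : ℝ := h ^ ((2:ℝ)/3) with hq
  have hq0 : 0 < q := Real.rpow_pos_of_pos hh _
  have hq1 : q ≤ 1 := Real.rpow_le_one hh.le hh1 (by norm_num)
  have hp : h ^ ((4:ℝ)/3) = q ^ 2 := by
    rw [hq, ← Real.rpow_natCast, ← Real.rpow_mul hh.le]; norm_num
  have hq3 : h ^ 2 = q ^ 3 := by
    rw [hq, ← Real.rpow_natCast, ← Real.rpow_natCast, ← Real.rpow_mul hh.le]; norm_num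
  set s : ℝ := κ / q ^ 2 with hsdef
  have hs1 : 1 ≤ s := by
    rw [hsdef, le_div_iff₀ (by positivity)]
    nlinarith
  have hw : ∀ x : EuclideanSpace ℝ (Fin d), 2 * (κ / 2 * (x i0 + (R + 1)) ^ 2) / h ^ ((4:ℝ)/3)
      = s * (x i0 + (R + 1)) ^ 2 := by
    intro x; rw [hp, hsdef]; field_simp
  simp only [hw]
  obtain ⟨c1, c2⟩ := Carl.complexC i0 (R + 1) s hs1 hK hyK hu h0
  simp only [← Carl.lapC_eq hu] at c1 c2
  have cw : Continuous fun x : EuclideanSpace ℝ (Fin d) =>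
    Real.exp (s * (x i0 + (R + 1)) ^ 2) := by fun_prop
  have hDu := Carl.D_smooth hu
  have zD := Carl.D_zero hK.isClosed h0
  have zDD := fun i j => Carl.D_zero hK.isClosed (zD i) j
  have cu := hu.continuous
  have cL : Continuous (lapC u) := by
    have : lapC u = fun x => ∑ i, Carl.D i (Carl.D i u) x := funext (Carl.lapC_eq hu)
    rw [this]
    exact continuous_finsetSum _ fun i _ => (Carl.D_smooth (hDu i) i).continuous
  have zL : ∀ x ∉ Metric.closedBall (0 : EuclideanSpace ℝ (Fin d)) R, lapC u x = 0 := by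
    intro x hx
    rw [Carl.lapC_eq hu]; simp [zDD _ _ x hx]
  set w : EuclideanSpace ℝ (Fin d) → ℝ := fun x => Real.exp (s * (x i0 + (R + 1)) ^ 2) with hwdef
  have w0 : ∀ x, 0 < w x := fun x => Real.exp_pos _
  let P : EuclideanSpace ℝ (Fin d) → ℂ := fun x =>
    (-(h ^ 2) : ℝ) • lapC u x + (V x - ((lam:ℂ) ^ 2)) * u x
  change ∫ x, w x * (‖u x‖ ^ 2 + ‖h • fderiv ℝ u x‖ ^ 2) ≤ (11 / 2 / q) * ∫ x, w x * ‖P x‖ ^ 2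
  change 4 * s ^ 3 * ∫ x, w x * ‖u x‖ ^ 2 ≤ ∫ x, w x * ‖lapC u x‖ ^ 2 at c1
  change s * ∫ x, w x * ∑ i, ‖Carl.D i u x‖ ^ 2 ≤ 9 / 4 * ∫ x, w x * ‖lapC u x‖ ^ 2 at c2
  have iu : Integrable fun x => w x * ‖u x‖ ^ 2 :=
    Carl.int_of hK (by fun_prop) fun x hx => by simp [h0 x hx]
  have iL : Integrable fun x => w x * ‖lapC u x‖ ^ 2 :=
    Carl.int_of hK (by fun_prop) fun x hx => by simp [zL x hx]
  have iN : Integrable fun x => w x * ∑ i, ‖Carl.D i u x‖ ^ 2 :=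
    Carl.int_of hK (cw.mul (continuous_finsetSum _ fun i _ => (hDu i).continuous.norm.pow 2))
      fun x hx => by simp [zD _ x hx]
  have hVl : ∀ x, ‖(V x - ((lam:ℂ) ^ 2)) * u x‖ ≤ M * ‖u x‖ := by
    intro x
    rw [norm_mul]
    refine mul_le_mul_of_nonneg_right ?_ (norm_nonneg _)
    refine (norm_sub_le _ _).trans ?_
    have h1 : ‖(lam:ℂ) ^ 2‖ = lam ^ 2 := by
      rw [norm_pow, Complex.norm_real, Real.norm_eq_abs, sq_abs]
    have h2 : lam ^ 2 ≤ a ^ 2 + b ^ 2 := by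
      obtain ⟨l1, l2⟩ := hlam
      rcases le_total 0 lam with h | h <;> nlinarith [sq_nonneg a, sq_nonneg b]
    rw [h1]
    linarith [hVbd x]
  have hnl : ∀ x, ‖(-(h ^ 2) : ℝ) • lapC u x‖ = q ^ 3 * ‖lapC u x‖ := by
    intro x
    rw [norm_smul, norm_neg, Real.norm_eq_abs, abs_of_nonneg (by positivity), hq3]
  have iP : Integrable fun x => w x * ‖P x‖ ^ 2 := by
    refine Integrable.mono' (g := fun x => 2 * q ^ 6 * (w x * ‖lapC u x‖ ^ 2) +
      2 * M ^ 2 * (w x * ‖u x‖ ^ 2)) ((iL.const_mul _).add (iu.const_mul _)) ?_ ?_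
    · have hPm : Measurable P :=
        Measurable.add (f := fun x => (-(h ^ 2) : ℝ) • lapC u x)
          (g := fun x => (V x - ((lam:ℂ) ^ 2)) * u x) (cL.const_smul (-(h ^ 2) : ℝ)).measurable
          (Measurable.mul (f := fun x => V x - ((lam:ℂ) ^ 2))
            (hVmeas.sub measurable_const) cu.measurable)
      exact (cw.measurable.mul (hPm.norm.pow_const 2)).aestronglyMeasurable
    · refine Filter.Eventually.of_forall fun x => ?_
      rw [Real.norm_eq_abs, abs_of_nonneg (mul_nonneg (w0 x).le (sq_nonneg _))]
      have h1 : ‖P x‖ ≤ q ^ 3 * ‖lapC u x‖ + M * ‖u x‖ :=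
        (norm_add_le _ _).trans (add_le_add (hnl x).le (hVl x))
      have h2 : ‖P x‖ ^ 2 ≤ 2 * q ^ 6 * ‖lapC u x‖ ^ 2 + 2 * M ^ 2 * ‖u x‖ ^ 2 := by
        have := pow_le_pow_left₀ (norm_nonneg _) h1 2
        nlinarith [sq_nonneg (q ^ 3 * ‖lapC u x‖ - M * ‖u x‖)]
      have := mul_le_mul_of_nonneg_left h2 (w0 x).le
      linarith
  have b1 : q ^ 6 * ∫ x, w x * ‖lapC u x‖ ^ 2 ≤
      2 * (∫ x, w x * ‖P x‖ ^ 2) + 2 * M ^ 2 * ∫ x, w x * ‖u x‖ ^ 2 := by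
    rw [← integral_const_mul, ← integral_const_mul, ← integral_const_mul,
      ← integral_add (iP.const_mul _) (iu.const_mul _)]
    refine integral_mono (iL.const_mul _) ((iP.const_mul _).add (iu.const_mul _)) fun x => ?_
    have h1 : q ^ 3 * ‖lapC u x‖ ≤ ‖P x‖ + M * ‖u x‖ := by
      rw [← hnl]
      have : (-(h ^ 2) : ℝ) • lapC u x = P x - (V x - ((lam:ℂ) ^ 2)) * u x := by simp [P]
      rw [this]
      exact (norm_sub_le _ _).trans (by linarith [hVl x])
    have h2 : q ^ 6 * ‖lapC u x‖ ^ 2 ≤ 2 * ‖P x‖ ^ 2 + 2 * M ^ 2 * ‖u x‖ ^ 2 := by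
      have := pow_le_pow_left₀ (by positivity) h1 2
      nlinarith [sq_nonneg (‖P x‖ - M * ‖u x‖)]
    have := mul_le_mul_of_nonneg_left h2 (w0 x).le
    simp only
    linarith
  have b2 : ∫ x, w x * (‖u x‖ ^ 2 + ‖h • fderiv ℝ u x‖ ^ 2) ≤
      (∫ x, w x * ‖u x‖ ^ 2) + q ^ 3 * ∫ x, w x * ∑ i, ‖Carl.D i u x‖ ^ 2 := by
    rw [← integral_const_mul, ← integral_add iu (iN.const_mul _)]
    refine integral_mono_of_nonneg (Filter.Eventually.of_forall fun x => ?_)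
      (iu.add (iN.const_mul _)) (Filter.Eventually.of_forall fun x => ?_)
    · have := w0 x
      simp only [Pi.zero_apply]; positivity
    · have h1 : ‖h • fderiv ℝ u x‖ ^ 2 ≤ q ^ 3 * ∑ i, ‖Carl.D i u x‖ ^ 2 := by
        rw [norm_smul, mul_pow, Real.norm_eq_abs, sq_abs, hq3]
        exact mul_le_mul_of_nonneg_left (Carl.norm_fderiv_le u x) (by positivity)
      have := mul_le_mul_of_nonneg_left h1 (w0 x).le
      simp only
      linarith
  have I0 : 0 ≤ ∫ x, w x * ‖u x‖ ^ 2 :=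
    integral_nonneg fun x => mul_nonneg (w0 x).le (sq_nonneg _)
  have IP0 : 0 ≤ ∫ x, w x * ‖P x‖ ^ 2 :=
    integral_nonneg fun x => mul_nonneg (w0 x).le (sq_nonneg _)
  refine b2.trans ?_
  exact Carl.arith hq0 hq1 hsdef hκ hκ1 I0 IP0 c1 c2 b1
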